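/- arXiv:1605.09003 — 3 statements merged into one kernel-verified Lean document; each statement's English description precedes it below -/
import Mathlib

section
/- Suppose m = 2r and let 1 ≤ a ≤ r − 1 be an integer. Then the Schubert variety X(F^a, F̃^r) of OG(2, ℂ^{2r}) is horizontal. -/
/-!
Orthogonal Grassmannian OG(2, ℂ^m) setup (0-based indexing: the paper's `e_k`
is `e m ⟨k-1, _⟩`, and the paper's condition `i + j = m + 1` on 1-based indices
becomes `j = i.rev` on 0-based indices).
-/

noncomputable section

/-- The standard basis vector `e_{i+1}` of `ℂ^m`. -/
def e (m : ℕ) (i : Fin m) : Fin m → ℂ := Pi.single i 1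

/-- The symmetric bilinear form `ν` with `ν(e_i, e_j) = 1` iff `i + j = m + 1`
(1-based), i.e. `ν(x, y) = ∑ i, x i * y (rev i)`. -/
def nu (m : ℕ) (x y : Fin m → ℂ) : ℂ := ∑ i : Fin m, x i * y i.rev

/-- `F m p` is the span `F^p` of the first `p` standard basis vectors. -/
def F (m p : ℕ) : Submodule ℂ (Fin m → ℂ) :=
  Submodule.span ℂ {v | ∃ i : Fin m, (i : ℕ) < p ∧ v = e m i}

/-- A subspace is `ν`-isotropic if `ν` vanishes identically on it. -/
def IsIsotropic (m : ℕ) (E : Submodule ℂ (Fin m → ℂ)) : Prop :=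
  ∀ x ∈ E, ∀ y ∈ E, nu m x y = 0

/-- The Schubert variety `X(A, B)` of `OG(2, ℂ^m)`: 2-dimensional `ν`-isotropic
subspaces `E` with `E ∩ A ≠ 0` and `E ⊆ B`. -/
def SchubX (m : ℕ) (A B : Submodule ℂ (Fin m → ℂ)) : Set (Submodule ℂ (Fin m → ℂ)) :=
  {E | Module.finrank ℂ E = 2 ∧ IsIsotropic m E ∧ E ⊓ A ≠ ⊥ ∧ E ≤ B}

/-- `X(A, B)` is horizontal: for all differentiable curves `v₁ ∈ A`, `v₂ ∈ B`
which stay linearly independent and span a `ν`-isotropic plane, each `v_i`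
pairs to zero with each derivative `v_j'`. -/
def Horizontal (m : ℕ) (A B : Submodule ℂ (Fin m → ℂ)) : Prop :=
  ∀ v₁ v₂ : ℝ → (Fin m → ℂ),
    Differentiable ℝ v₁ → Differentiable ℝ v₂ →
    (∀ t, v₁ t ∈ A) → (∀ t, v₂ t ∈ B) →
    (∀ t, LinearIndependent ℂ ![v₁ t, v₂ t]) →
    (∀ t, IsIsotropic m (Submodule.span ℂ {v₁ t, v₂ t})) →
    ∀ t : ℝ,
      nu m (v₁ t) (deriv v₁ t) = 0 ∧ nu m (v₁ t) (deriv v₂ t) = 0 ∧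
      nu m (v₂ t) (deriv v₁ t) = 0 ∧ nu m (v₂ t) (deriv v₂ t) = 0

/-- For `m = 2r`, `F̃^r` is the span of `e_1, …, e_{r−1}, e_{r+1}`
(0-based: indices `< r - 1` together with index `r`). -/
def Ftilde (r : ℕ) : Submodule ℂ (Fin (2 * r) → ℂ) :=
  Submodule.span ℂ
    {v | ∃ i : Fin (2 * r), ((i : ℕ) < r - 1 ∨ (i : ℕ) = r) ∧ v = e (2 * r) i}

/-- A vector in the span of some standard basis vectors has vanishing coordinates elsewhere. -/
theorem apply_eq_zero_of_mem_span_e {m : ℕ} {p : Fin m → Prop} {x : Fin m → ℂ}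
    (hx : x ∈ Submodule.span ℂ {v | ∃ i : Fin m, p i ∧ v = e m i}) {j : Fin m} (hj : ¬ p j) :
    x j = 0 := by
  induction hx using Submodule.span_induction with
  | mem v hv =>
    obtain ⟨i, hi, rfl⟩ := hv
    have hne : j ≠ i := by
      rintro rfl
      exact hj hi
    exact Pi.single_eq_of_ne hne _
  | zero => rfl
  | add u v _ _ hu hv => simp [hu, hv]
  | smul c v _ hv => simp [hv]

/-- If a coordinate of a differentiable curve vanishes identically, so does that coordinate of
its derivative. -/
theorem deriv_apply_eq_zero {m : ℕ} {v : ℝ → Fin m → ℂ} (hv : Differentiable ℝ v) {j : Fin m}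
    (h : ∀ t, v t j = 0) (t : ℝ) : deriv v t j = 0 := by
  have hd := hasDerivAt_pi.mp (hv t).hasDerivAt j
  simp only [h] at hd
  exact hd.unique (hasDerivAt_const t 0)

/-- `ν` vanishes on pairs of vectors supported on a set of indices disjoint from its reversal. -/
theorem nu_eq_zero_of_support {m : ℕ} {p : Fin m → Prop} (hp : ∀ i, p i → ¬ p i.rev)
    {x y : Fin m → ℂ} (hx : ∀ i, ¬ p i → x i = 0) (hy : ∀ i, ¬ p i → y i = 0) :
    nu m x y = 0 := by
  refine Finset.sum_eq_zero fun i _ => ?_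
  by_cases hi : p i
  · rw [hy _ (hp i hi), mul_zero]
  · rw [hx i hi, zero_mul]

theorem F_le_Ftilde {r a : ℕ} (har : a ≤ r - 1) : F (2 * r) a ≤ Ftilde r :=
  Submodule.span_mono fun _ ⟨i, hi, hv⟩ => ⟨i, Or.inl (hi.trans_le har), hv⟩

/-- For `m = 2r` and `1 ≤ a ≤ r − 1`, the Schubert variety
`X(F^a, F̃^r)` of `OG(2, ℂ^{2r})` is horizontal. -/
theorem stmt2 (r a : ℕ) (ha : 1 ≤ a) (har : a ≤ r - 1) :
    Horizontal (2 * r) (F (2 * r) a) (Ftilde r) := by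
  intro v₁ v₂ hd₁ hd₂ h₁ h₂ _ _ t
  have hp : ∀ i : Fin (2 * r), ((i : ℕ) < r - 1 ∨ (i : ℕ) = r) →
      ¬ ((i.rev : ℕ) < r - 1 ∨ (i.rev : ℕ) = r) := by
    intro i hi
    rw [Fin.val_rev]
    omega
  have z₁ : ∀ i : Fin (2 * r), ¬ ((i : ℕ) < r - 1 ∨ (i : ℕ) = r) → ∀ s, v₁ s i = 0 :=
    fun _ hi s => apply_eq_zero_of_mem_span_e (F_le_Ftilde har (h₁ s)) hi
  have z₂ : ∀ i : Fin (2 * r), ¬ ((i : ℕ) < r - 1 ∨ (i : ℕ) = r) → ∀ s, v₂ s i = 0 :=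
    fun _ hi s => apply_eq_zero_of_mem_span_e (h₂ s) hi
  have w₁ := fun i hi => deriv_apply_eq_zero hd₁ (z₁ i hi) t
  have w₂ := fun i hi => deriv_apply_eq_zero hd₂ (z₂ i hi) t
  exact ⟨nu_eq_zero_of_support hp (fun i hi => z₁ i hi t) w₁,
    nu_eq_zero_of_support hp (fun i hi => z₁ i hi t) w₂,
    nu_eq_zero_of_support hp (fun i hi => z₂ i hi t) w₁,
    nu_eq_zero_of_support hp (fun i hi => z₂ i hi t) w₂⟩

end
end

section
/- Suppose m = 2r and let b be an integer with r + 2 ≤ b ≤ 2r. Then the Schubert variety X(F̃^r, F^b) of OG(2, ℂ^{2r}) is not horizontal. -/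
/-!
Orthogonal Grassmannian OG(2, ℂ^m) setup (0-based indexing: the paper's `e_k`
is `e m ⟨k-1, _⟩`, and the paper's condition `i + j = m + 1` on 1-based indices
becomes `j = i.rev` on 0-based indices).
-/

noncomputable section

theorem nu_add_left (m : ℕ) (x y z : Fin m → ℂ) :
    nu m (x + y) z = nu m x z + nu m y z := by
  simp [nu, add_mul, Finset.sum_add_distrib]

theorem nu_add_right (m : ℕ) (x y z : Fin m → ℂ) :
    nu m x (y + z) = nu m x y + nu m x z := by
  simp [nu, mul_add, Finset.sum_add_distrib]

theorem nu_smul_left (m : ℕ) (c : ℂ) (x y : Fin m → ℂ) :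
    nu m (c • x) y = c * nu m x y := by
  simp [nu, Finset.mul_sum, mul_assoc]

theorem nu_smul_right (m : ℕ) (c : ℂ) (x y : Fin m → ℂ) :
    nu m x (c • y) = c * nu m x y := by
  simp [nu, Finset.mul_sum, mul_left_comm]

theorem nu_e_e (m : ℕ) (i j : Fin m) :
    nu m (e m i) (e m j) = if i.rev = j then 1 else 0 := by
  rw [nu, Finset.sum_eq_single i] <;> simp +contextual [e, Pi.single_apply]

/-- A plane spanned by two vectors on which `ν` vanishes pairwise is isotropic. -/
theorem isIsotropic_span_pair (m : ℕ) (u v : Fin m → ℂ) (huu : nu m u u = 0)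
    (huv : nu m u v = 0) (hvu : nu m v u = 0) (hvv : nu m v v = 0) :
    IsIsotropic m (Submodule.span ℂ {u, v}) := by
  intro x hx y hy
  obtain ⟨a, b, rfl⟩ := Submodule.mem_span_pair.1 hx
  obtain ⟨c, d, rfl⟩ := Submodule.mem_span_pair.1 hy
  simp [nu_add_left, nu_add_right, nu_smul_left, nu_smul_right, huu, huv, hvu, hvv]

/-- The affine line `t ↦ x + t • y` has derivative `y`. -/
theorem hasDerivAt_line (m : ℕ) (x y : Fin m → ℂ) (t : ℝ) :
    HasDerivAt (fun t : ℝ => x + (t : ℂ) • y) y t := by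
  simpa using ((Complex.ofRealCLM.hasDerivAt (x := t)).smul_const y).const_add x

/-- For `m = 2r` and `r + 2 ≤ b ≤ 2r`, the Schubert variety
`X(F̃^r, F^b)` of `OG(2, ℂ^{2r})` is not horizontal. -/
theorem stmt3 (r b : ℕ) (hb1 : r + 2 ≤ b) (hb2 : b ≤ 2 * r) :
    ¬ Horizontal (2 * r) (Ftilde r) (F (2 * r) b) := by
  obtain ⟨i, hi⟩ : ∃ i : Fin (2 * r), (i : ℕ) = r - 2 := ⟨⟨r - 2, by omega⟩, rfl⟩
  obtain ⟨j, hj⟩ : ∃ j : Fin (2 * r), (j : ℕ) = r := ⟨⟨r, by omega⟩, rfl⟩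
  have hi' : (i.rev : ℕ) = r + 1 := by rw [Fin.val_rev]; omega
  have hj' : (j.rev : ℕ) = r - 1 := by rw [Fin.val_rev]; omega
  have hij : i ≠ j := fun h => by have := congrArg Fin.val h; omega
  have hij' : i.rev ≠ j := fun h => by have := congrArg Fin.val h; omega
  have hji' : j.rev ≠ i := fun h => by have := congrArg Fin.val h; omega
  have hii : i.rev ≠ i := fun h => by have := congrArg Fin.val h; omega
  have hjj : j.rev ≠ j := fun h => by have := congrArg Fin.val h; omega
  intro H
  have h₁ := hasDerivAt_line (2 * r) (e _ j) (e _ i)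
  have h₂ := hasDerivAt_line (2 * r) (e _ i.rev) (-e _ j.rev)
  have key := (H (fun t => e _ j + (t : ℂ) • e _ i)
    (fun t => e _ i.rev + (t : ℂ) • -e _ j.rev)
    (fun t => (h₁ t).differentiableAt) (fun t => (h₂ t).differentiableAt)
    (fun t => ?_) (fun t => ?_) (fun t => ?_) (fun t => ?_) 0).2.2.1
  · rw [(h₁ 0).deriv] at key
    simp [nu_e_e] at key
  · exact add_mem (Submodule.subset_span ⟨j, by omega, rfl⟩)
      (Submodule.smul_mem _ _ (Submodule.subset_span ⟨i, by omega, rfl⟩))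
  · exact add_mem (Submodule.subset_span ⟨i.rev, by omega, rfl⟩)
      (Submodule.smul_mem _ _ (neg_mem (Submodule.subset_span ⟨j.rev, by omega, rfl⟩)))
  · rw [LinearIndependent.pair_iff]
    intro a c hac
    have ha := congrFun hac j
    have hc := congrFun hac i.rev
    simp [e, hij, hij.symm, hij', hij'.symm, hii, hjj.symm] at ha hc
    exact ⟨ha, hc⟩
  · apply isIsotropic_span_pair <;>
      simp only [smul_neg, ← neg_smul, nu_add_left, nu_add_right, nu_smul_left, nu_smul_right,
        nu_e_e] <;>
      simp [hij, hij.symm, hij', hij'.symm, hji', hji'.symm, hii, hii.symm, hjj, hjj.symm]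

end
end

section
/- Let (W, S) be a Coxeter system with simple reflections s_j indexed by j in an index type J. Fix i ∈ J and let K ⊆ J be a set of indices with i ∉ K such that s_i · s_j = s_j · s_i for every j ∈ K. Let W_Q be the subgroup of W generated by {s_i} ∪ {s_j : j ∈ K}, and let W_P be the subgroup of W generated by {s_j : j ∈ J, j ≠ i}. Then every element u ∈ W_Q satisfies u ∈ W_P or u · s_i ∈ W_P; that is, W_Q ⊆ W_P ∪ W_P·s_i. -/
/-- Let `(W, S)` be a Coxeter system with simple reflections
`s_j` indexed by `j : J`.  Fix `i : J` and a set `K ⊆ J` with `i ∉ K` such that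
`s_i` commutes with `s_j` for every `j ∈ K`.  Let `W_Q` be the subgroup
generated by `{s_i} ∪ {s_j : j ∈ K}` and `W_P` the subgroup generated by
`{s_j : j ≠ i}`.  Then every `u ∈ W_Q` satisfies `u ∈ W_P` or `u * s_i ∈ W_P`,
i.e. `W_Q ⊆ W_P ∪ W_P · s_i`. -/
theorem stmt7 {J W : Type*} [Group W] {M : CoxeterMatrix J} (cs : CoxeterSystem M W)
    (i : J) (K : Set J) (hiK : i ∉ K)
    (hcomm : ∀ j ∈ K, cs.simple i * cs.simple j = cs.simple j * cs.simple i)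
    (WQ WP : Subgroup W)
    (hWQ : WQ = Subgroup.closure ({cs.simple i} ∪ (cs.simple '' K)))
    (hWP : WP = Subgroup.closure (cs.simple '' {j | j ≠ i})) :
    ∀ u ∈ WQ, u ∈ WP ∨ u * cs.simple i ∈ WP := by
  subst hWQ hWP
  have hsimple : ∀ j ∈ K,
      cs.simple j ∈ Subgroup.closure (cs.simple '' {j | j ≠ i}) := fun j hj =>
    Subgroup.subset_closure ⟨j, fun h => hiK (h ▸ hj), rfl⟩
  have hstep : ∀ x, ∀ y ∈ ({cs.simple i} ∪ cs.simple '' K : Set W),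
      (x ∈ Subgroup.closure (cs.simple '' {j | j ≠ i}) ∨
        x * cs.simple i ∈ Subgroup.closure (cs.simple '' {j | j ≠ i})) →
      (x * y ∈ Subgroup.closure (cs.simple '' {j | j ≠ i}) ∨
        x * y * cs.simple i ∈ Subgroup.closure (cs.simple '' {j | j ≠ i})) := by
    rintro x y (rfl | ⟨j, hj, rfl⟩) (hx | hx)
    · exact Or.inr (by simpa [mul_assoc] using hx)
    · exact Or.inl hx
    · exact Or.inl (mul_mem hx (hsimple j hj))
    · refine Or.inr ?_
      rw [mul_assoc, ← hcomm j hj, ← mul_assoc]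
      exact mul_mem hx (hsimple j hj)
  have hinv : ∀ y ∈ ({cs.simple i} ∪ cs.simple '' K : Set W), y⁻¹ = y := by
    rintro y (rfl | ⟨j, -, rfl⟩) <;> exact cs.inv_simple _
  intro u hu
  induction hu using Subgroup.closure_induction_right with
  | one => exact Or.inl (one_mem _)
  | mul_right x _ y hy ih => exact hstep x y hy ih
  | mul_inv_cancel x _ y hy ih => rw [hinv y hy]; exact hstep x y hy ih
end
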